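/- Let B₁, …, B₁₄ be the following fourteen 7-element subsets of ℤ/589ℤ: {0,1,4,258,357,455,572}, {0,2,7,223,242,401,520}, {0,6,73,102,112,393,534}, {0,8,251,341,426,527,555}, {0,9,103,118,316,330,523}, {0,11,95,160,187,239,369}, {0,12,237,267,318,390,501}, {0,13,57,120,230,509,557}, {0,16,124,177,263,443,558}, {0,20,136,174,439,476,553}, {0,22,68,127,272,312,463}, {0,23,58,224,284,367,525}, {0,24,78,121,203,421,563}, {0,25,74,165,206,425,458}. Then the difference sets ΔB₁, …, ΔB₁₄ are pairwise disjoint, each has cardinality 42, and their union is (ℤ/589ℤ) \ {0}; consequently the translates {Bᵢ + g : 1 ≤ i ≤ 14, g ∈ ℤ/589ℤ} form the block set of a Steiner system S(2,7,589) on ℤ/589ℤ. -/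

import Mathlib

/-- The set of differences `ΔB = {a - c : a, c ∈ B, a ≠ c}`. -/
def diffSet (B : Finset (ZMod 589)) : Finset (ZMod 589) :=
  ((B ×ˢ B).filter fun p => p.1 ≠ p.2).image fun p => p.1 - p.2

/-- The 14 base blocks of the difference family on `ZMod 589`. -/
def baseBlocks : Fin 14 → Finset (ZMod 589) :=
  ![({0,1,4,258,357,455,572} : Finset (ZMod 589)),
   ({0,2,7,223,242,401,520} : Finset (ZMod 589)),
   ({0,6,73,102,112,393,534} : Finset (ZMod 589)),
   ({0,8,251,341,426,527,555} : Finset (ZMod 589)),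
   ({0,9,103,118,316,330,523} : Finset (ZMod 589)),
   ({0,11,95,160,187,239,369} : Finset (ZMod 589)),
   ({0,12,237,267,318,390,501} : Finset (ZMod 589)),
   ({0,13,57,120,230,509,557} : Finset (ZMod 589)),
   ({0,16,124,177,263,443,558} : Finset (ZMod 589)),
   ({0,20,136,174,439,476,553} : Finset (ZMod 589)),
   ({0,22,68,127,272,312,463} : Finset (ZMod 589)),
   ({0,23,58,224,284,367,525} : Finset (ZMod 589)),
   ({0,24,78,121,203,421,563} : Finset (ZMod 589)),
   ({0,25,74,165,206,425,458} : Finset (ZMod 589))]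

/-- If the blocks of a family have at most `|G| - 1` ordered pairs of distinct elements altogether
and every nonzero element of `G` is a difference of such a pair, then it is so in a unique way. -/
theorem injOn_sub_of_forall_exists_sub_eq {ι G : Type*} [Fintype ι] [AddGroup G] [Fintype G]
    [DecidableEq G] (B : ι → Finset G) (hcard : ∑ i, (B i).offDiag.card ≤ Fintype.card G - 1)
    (hcover : ∀ d : G, d ≠ 0 → ∃ i, ∃ a ∈ B i, ∃ c ∈ B i, a - c = d) :
    Set.InjOn (fun t : (_ : ι) × G × G => t.2.1 - t.2.2)
      (Finset.univ.sigma fun i => (B i).offDiag) := by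
  intro s hs t ht hst
  refine Finset.inj_on_of_surj_on_of_card_le (t := Finset.univ \ {(0 : G)})
    (fun (t : (_ : ι) × G × G) _ => t.2.1 - t.2.2) ?_ ?_ ?_ hs ht hst
  · rintro ⟨i, a, c⟩ h
    simp only [Finset.mem_sigma, Finset.mem_univ, true_and, Finset.mem_offDiag] at h
    simpa [sub_eq_zero] using h.2.2
  · intro d hd
    have hd0 : d ≠ 0 := by simpa using hd
    obtain ⟨i, a, ha, c, hc, rfl⟩ := hcover d hd0
    exact ⟨⟨i, a, c⟩, by simpa [ha, hc, sub_eq_zero] using hd0, rfl⟩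
  · rw [Finset.card_sigma, Finset.card_sdiff_of_subset (Finset.subset_univ _),
      Finset.card_singleton]
    exact hcard

theorem mem_diffSet {B : Finset (ZMod 589)} {d : ZMod 589} :
    d ∈ diffSet B ↔ ∃ a ∈ B, ∃ c ∈ B, a ≠ c ∧ a - c = d := by
  simp only [diffSet, Finset.mem_image, Finset.mem_filter, Finset.mem_product, Prod.exists]
  grind

theorem diffSet_eq_image_offDiag (B : Finset (ZMod 589)) :
    diffSet B = B.offDiag.image fun p => p.1 - p.2 := by
  ext d
  simp only [mem_diffSet, Finset.mem_image, Finset.mem_offDiag, Prod.exists]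
  grind

theorem card_baseBlocks (i : Fin 14) : (baseBlocks i).card = 7 := by
  revert i
  decide +kernel

/-- The base blocks as lists of natural numbers, on which differences are fast to compute. -/
def natBlocks : List (List ℕ) :=
  [[0, 1, 4, 258, 357, 455, 572],
   [0, 2, 7, 223, 242, 401, 520],
   [0, 6, 73, 102, 112, 393, 534],
   [0, 8, 251, 341, 426, 527, 555],
   [0, 9, 103, 118, 316, 330, 523],
   [0, 11, 95, 160, 187, 239, 369],
   [0, 12, 237, 267, 318, 390, 501],
   [0, 13, 57, 120, 230, 509, 557],
   [0, 16, 124, 177, 263, 443, 558],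
   [0, 20, 136, 174, 439, 476, 553],
   [0, 22, 68, 127, 272, 312, 463],
   [0, 23, 58, 224, 284, 367, 525],
   [0, 24, 78, 121, 203, 421, 563],
   [0, 25, 74, 165, 206, 425, 458]]

theorem exists_baseBlocks_of_mem_natBlocks :
    ∀ B ∈ natBlocks, ∃ i, ∀ a ∈ B, (a : ZMod 589) ∈ baseBlocks i := by
  decide +kernel

theorem testBit_foldr_two_pow_or (l : List ℕ) (d : ℕ) :
    (l.foldr (fun k m => 2 ^ k ||| m) 0).testBit d = true ↔ d ∈ l := by
  induction l with
  | nil => simp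
  | cons k l ih =>
    rw [List.foldr_cons, Nat.testBit_or, Bool.or_eq_true, ih, Nat.testBit_two_pow, List.mem_cons,
      decide_eq_true_eq, eq_comm]

/-- The differences modulo 589 of the elements of the base blocks. -/
def natDiffs : List ℕ :=
  natBlocks.flatMap fun B => B.flatMap fun c => B.map fun a => (a + (589 - c)) % 589

theorem foldr_natDiffs : natDiffs.foldr (fun k m => 2 ^ k ||| m) 0 = 2 ^ 589 - 1 := by
  decide +kernel

theorem forall_mem_natBlocks_le : ∀ B ∈ natBlocks, ∀ c ∈ B, c ≤ 589 := by
  decide +kernel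

theorem exists_sub_eq (d : ZMod 589) :
    ∃ i, ∃ a ∈ baseBlocks i, ∃ c ∈ baseBlocks i, a - c = d := by
  have h : d.val ∈ natDiffs := by
    rw [← testBit_foldr_two_pow_or, foldr_natDiffs, Nat.testBit_two_pow_sub_one]
    exact decide_eq_true d.val_lt
  simp only [natDiffs, List.mem_flatMap, List.mem_map] at h
  obtain ⟨B, hB, c, hc, a, ha, h⟩ := h
  obtain ⟨i, hi⟩ := exists_baseBlocks_of_mem_natBlocks B hB
  refine ⟨i, a, hi a ha, c, hi c hc, ?_⟩
  rw [← ZMod.natCast_zmod_val d, ← h, ZMod.natCast_mod, Nat.cast_add,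
    Nat.cast_sub (forall_mem_natBlocks_le B hB c hc), ZMod.natCast_self, zero_sub, sub_eq_add_neg]

theorem card_offDiag_baseBlocks (i : Fin 14) : (baseBlocks i).offDiag.card = 42 := by
  rw [Finset.offDiag_card, card_baseBlocks]

theorem baseBlocks_sub_injective {i j : Fin 14} {a c a' c' : ZMod 589}
    (ha : a ∈ baseBlocks i) (hc : c ∈ baseBlocks i) (ha' : a' ∈ baseBlocks j)
    (hc' : c' ∈ baseBlocks j) (hac : a ≠ c) (h : a - c = a' - c') :
    i = j ∧ a = a' ∧ c = c' := by
  have hac' : a' ≠ c' := by rwa [← sub_ne_zero, ← h, sub_ne_zero]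
  have hinj := injOn_sub_of_forall_exists_sub_eq baseBlocks
    (by simp only [card_offDiag_baseBlocks]; simp) fun d _ => exists_sub_eq d
  have heq := @hinj ⟨i, a, c⟩ (by simp [ha, hc, hac]) ⟨j, a', c'⟩
    (by simp [ha', hc', hac']) h
  simpa using heq

/-- The given 14 base blocks form a difference family on `ℤ/589ℤ`: their difference
sets are pairwise disjoint, each has 42 elements, and their union is `ℤ/589ℤ \ {0}`;
consequently the translates `Bᵢ + g` form the block set of a Steiner system
`S(2,7,589)` on `ℤ/589ℤ`. -/
theorem difference_family_zmod_589_8 :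
    (∀ i j, i ≠ j → Disjoint (diffSet (baseBlocks i)) (diffSet (baseBlocks j))) ∧
    (∀ i, (diffSet (baseBlocks i)).card = 42) ∧
    ((Finset.univ.biUnion fun i => diffSet (baseBlocks i)) = Finset.univ \ {0}) ∧
    ∀ p : Finset (ZMod 589), p.card = 2 →
      ∃! b, b ∈ (Finset.univ.image fun ig : Fin 14 × ZMod 589 =>
          (baseBlocks ig.1).image (· + ig.2)) ∧ p ⊆ b := by
  refine ⟨fun i j hij => ?_, fun i => ?_, ?_, fun p hp => ?_⟩
  · rw [Finset.disjoint_left]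
    intro d hi hj
    obtain ⟨a, ha, c, hc, hac, rfl⟩ := mem_diffSet.1 hi
    obtain ⟨a', ha', c', hc', -, h⟩ := mem_diffSet.1 hj
    exact hij (baseBlocks_sub_injective ha hc ha' hc' hac h.symm).1
  · rw [diffSet_eq_image_offDiag, Finset.card_image_of_injOn, card_offDiag_baseBlocks]
    rintro ⟨a, c⟩ hac ⟨a', c'⟩ hac' h
    simp only [Finset.mem_coe, Finset.mem_offDiag] at hac hac'
    obtain ⟨-, rfl, rfl⟩ :=
      baseBlocks_sub_injective hac.1 hac.2.1 hac'.1 hac'.2.1 hac.2.2 h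
    rfl
  · ext d
    simp only [Finset.mem_biUnion, Finset.mem_univ, true_and, Finset.mem_sdiff,
      Finset.mem_singleton, mem_diffSet]
    constructor
    · rintro ⟨i, a, -, c, -, hac, rfl⟩
      exact sub_ne_zero.2 hac
    · intro hd
      obtain ⟨i, a, ha, c, hc, rfl⟩ := exists_sub_eq d
      exact ⟨i, a, ha, c, hc, sub_ne_zero.1 hd, rfl⟩
  · obtain ⟨x, y, hxy, rfl⟩ := Finset.card_eq_two.1 hp
    obtain ⟨i, a, ha, c, hc, h⟩ := exists_sub_eq (x - y)
    have hac : a ≠ c := by rwa [← sub_ne_zero, h, sub_ne_zero]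
    refine ⟨(baseBlocks i).image (· + (x - a)),
      ⟨Finset.mem_image.2 ⟨(i, x - a), Finset.mem_univ _, rfl⟩, ?_⟩, ?_⟩
    · simp only [Finset.insert_subset_iff, Finset.singleton_subset_iff, Finset.mem_image]
      exact ⟨⟨a, ha, by abel⟩, c, hc, by linear_combination -h⟩
    · rintro b ⟨hb, hsub⟩
      obtain ⟨⟨j, g⟩, -, rfl⟩ := Finset.mem_image.1 hb
      simp only [Finset.insert_subset_iff, Finset.singleton_subset_iff, Finset.mem_image] at hsub
      obtain ⟨⟨a', ha', rfl⟩, c', hc', rfl⟩ := hsub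
      obtain ⟨rfl, rfl, rfl⟩ :=
        baseBlocks_sub_injective ha hc ha' hc' hac (by linear_combination h)
      simp
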